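/- For every n ≥ 3 and every 1 ≤ k ≤ n, the space of Chevalley–Eilenberg k-cocycles of m0(n) over F has the same dimension as the space of Chevalley–Eilenberg k-cocycles of m2(n) over F: dim Z_k(m0(n)) = dim Z_k(m2(n)). -/

import Mathlib

/-!
STATEMENT 6: For every n ≥ 3 and every 1 ≤ k ≤ n, the space of Chevalley–Eilenberg
k-cocycles of m0(n) over a field F of characteristic two has the same dimension as the
space of k-cocycles of m2(n): dim Z_k(m0(n)) = dim Z_k(m2(n)).

In characteristic two the Chevalley–Eilenberg complex of alternating forms is
(canonically) the exterior algebra Λ*(e^1,…,e^n) of the dual space, with differential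
the derivation determined by its values on the generators (no signs occur), and
Z_k = Λ^k ∩ ker d.
-/

noncomputable section
namespace Char2Filiform

/-- The exterior algebra of the dual space, Λ*(e^1,…,e^N). -/
abbrev XA (F : Type*) [Field F] (N : ℕ) := ExteriorAlgebra F (Fin N → F)

/-- The generator `e^{i+1}` (zero-indexed). -/
def gen (F : Type*) [Field F] (N : ℕ) (i : Fin N) : XA F N :=
  ExteriorAlgebra.ι F (Pi.single i (1 : F))

/-- Derivation property (no signs since the base field has characteristic two). -/
def IsDeriv (F : Type*) [Field F] (N : ℕ) (D : XA F N →ₗ[F] XA F N) : Prop :=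
  ∀ a b : XA F N, D (a * b) = D a * b + a * D b

/-- The subspace `Λ^k(e^1,…,e^N)` of forms of topological degree `k`. -/
def grade (F : Type*) [Field F] (N : ℕ) (k : ℕ) : Submodule F (XA F N) :=
  (LinearMap.range (ExteriorAlgebra.ι F (M := Fin N → F))) ^ k

/-- `d` is the Chevalley–Eilenberg differential of `m0(N)`. -/
def Isd0 (F : Type*) [Field F] (N : ℕ) (d : XA F N →ₗ[F] XA F N) : Prop :=
  IsDeriv F N d ∧
  (∀ i : Fin N, (i : ℕ) ≤ 1 → d (gen F N i) = 0) ∧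
  (∀ m : ℕ, (h : m + 3 ≤ N) →
    d (gen F N ⟨m + 2, by omega⟩) = gen F N ⟨0, by omega⟩ * gen F N ⟨m + 1, by omega⟩)

/-- `d` is the Chevalley–Eilenberg differential of `m2(N)`. -/
def Isd2 (F : Type*) [Field F] (N : ℕ) (d : XA F N →ₗ[F] XA F N) : Prop :=
  IsDeriv F N d ∧
  (∀ i : Fin N, (i : ℕ) ≤ 1 → d (gen F N i) = 0) ∧
  (∀ m : ℕ, (h : m + 3 ≤ N) → m ≤ 1 →
    d (gen F N ⟨m + 2, by omega⟩) = gen F N ⟨0, by omega⟩ * gen F N ⟨m + 1, by omega⟩) ∧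
  (∀ m : ℕ, (h : m + 5 ≤ N) →
    d (gen F N ⟨m + 4, by omega⟩) =
      gen F N ⟨0, by omega⟩ * gen F N ⟨m + 3, by omega⟩ +
      gen F N ⟨1, by omega⟩ * gen F N ⟨m + 2, by omega⟩)


/-- The space of `k`-cocycles `Z^k = Λ^k ∩ ker d`. -/
def cocycles (F : Type*) [Field F] (N : ℕ) (d : XA F N →ₗ[F] XA F N) (k : ℕ) :
    Submodule F (XA F N) :=
  grade F N k ⊓ LinearMap.ker d

section

variable {F : Type*} [Field F] {N : ℕ}

theorem add_self_eq_zero_of_charTwo [CharP F 2] {V : Type*} [AddCommGroup V] [Module F V]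
    (x : V) : x + x = 0 := by
  rw [← two_smul F x, CharTwo.two_eq_zero, zero_smul]

theorem XA.mul_comm [CharP F 2] (x y : XA F N) : x * y = y * x := by
  have swap (u v : Fin N → F) :
      ExteriorAlgebra.ι F u * ExteriorAlgebra.ι F v =
        ExteriorAlgebra.ι F v * ExteriorAlgebra.ι F u := by
    have h := ExteriorAlgebra.ι_add_mul_swap (R := F) u v
    rw [eq_neg_of_add_eq_zero_left h]
    exact neg_eq_of_add_eq_zero_left (add_self_eq_zero_of_charTwo (F := F) _)
  induction x using ExteriorAlgebra.induction with
  | algebraMap r => exact Algebra.commutes r y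
  | ι u =>
    induction y using ExteriorAlgebra.induction with
    | algebraMap r => exact (Algebra.commutes r _).symm
    | ι v => exact swap u v
    | mul a b ha hb => rw [← mul_assoc, ha, mul_assoc, hb, mul_assoc]
    | add a b ha hb => rw [mul_add, add_mul, ha, hb]
  | mul a b ha hb => rw [mul_assoc, hb, ← mul_assoc, ha, mul_assoc]
  | add a b ha hb => rw [mul_add, add_mul, ha, hb]

theorem gen_mul_self (i : Fin N) : gen F N i * gen F N i = 0 :=
  ExteriorAlgebra.ι_sq_zero _

namespace IsDeriv

variable {D D' : XA F N →ₗ[F] XA F N}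

theorem map_one (h : IsDeriv F N D) : D 1 = 0 := by
  simpa using h 1 1

theorem map_algebraMap (h : IsDeriv F N D) (r : F) : D (algebraMap F _ r) = 0 := by
  rw [Algebra.algebraMap_eq_smul_one, map_smul, h.map_one, smul_zero]

theorem ext (h : IsDeriv F N D) (h' : IsDeriv F N D')
    (hgen : ∀ i, D (gen F N i) = D' (gen F N i)) : D = D' := by
  have hι : D ∘ₗ ExteriorAlgebra.ι F = D' ∘ₗ ExteriorAlgebra.ι F := by
    refine LinearMap.pi_ext' fun i => LinearMap.ext_ring ?_
    exact hgen i
  refine LinearMap.ext fun x => ?_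
  induction x using ExteriorAlgebra.induction with
  | algebraMap r => rw [h.map_algebraMap, h'.map_algebraMap]
  | ι u => exact LinearMap.congr_fun hι u
  | mul a b ha hb => rw [h, h', ha, hb]
  | add a b ha hb => rw [map_add, map_add, ha, hb]

theorem zero : IsDeriv F N 0 := fun a b => by simp

theorem add (h : IsDeriv F N D) (h' : IsDeriv F N D') : IsDeriv F N (D + D') := fun a b => by
  simp only [LinearMap.add_apply, h a b, h' a b, add_mul, mul_add]
  abel

theorem sq [CharP F 2] (h : IsDeriv F N D) : IsDeriv F N (D * D) := fun a b => by
  have := add_self_eq_zero_of_charTwo (F := F) (D a * D b)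
  simp only [Module.End.mul_apply, h _ _, map_add]
  rw [add_assoc, ← add_assoc (D a * D b), this, zero_add]

theorem bracket [CharP F 2] (h : IsDeriv F N D) (h' : IsDeriv F N D') :
    IsDeriv F N (D * D' + D' * D) := fun a b => by
  have h₁ := add_self_eq_zero_of_charTwo (F := F) (D a * D' b)
  have h₂ := add_self_eq_zero_of_charTwo (F := F) (D' a * D b)
  simp only [LinearMap.add_apply, Module.End.mul_apply, h _ _, h' _ _, map_add, add_mul, mul_add]
  calc
    _ = D (D' a) * b + D' (D a) * b + (a * D (D' b) + a * D' (D b)) +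
        (D a * D' b + D a * D' b) + (D' a * D b + D' a * D b) := by abel
    _ = _ := by rw [h₁, h₂, add_zero, add_zero]

theorem mulLeft [CharP F 2] (h : IsDeriv F N D) (e : XA F N) :
    IsDeriv F N (LinearMap.mulLeft F e * D) := fun a b => by
  simp only [Module.End.mul_apply, LinearMap.mulLeft_apply, h a b, mul_add]
  rw [← mul_assoc, ← mul_assoc e a, XA.mul_comm e a, mul_assoc a]

theorem mem_grade (h : IsDeriv F N D) {j : ℕ}
    (hj : ∀ u, D (ExteriorAlgebra.ι F u) ∈ grade F N j) (k : ℕ) {x : XA F N}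
    (hx : x ∈ grade F N (k + 1)) : D x ∈ grade F N (k + j) := by
  induction k generalizing x with
  | zero =>
    rw [grade, zero_add, pow_one] at hx
    obtain ⟨u, rfl⟩ := hx
    simpa using hj u
  | succ k ih =>
    rw [grade, pow_succ] at hx
    induction hx using Submodule.mul_induction_on' with
    | mem_mul_mem m hm y hy =>
      rw [h]
      refine add_mem ?_ ?_
      · have := Submodule.mul_mem_mul (ih hm) hy
        rwa [grade, ← pow_succ, show k + j + 1 = k + 1 + j by omega] at this
      · obtain ⟨u, rfl⟩ := hy
        have := Submodule.mul_mem_mul hm (hj u)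
        rwa [grade, ← pow_add] at this
    | add x _ y _ hx hy => rw [map_add]; exact add_mem hx hy

end IsDeriv

/-- Contraction of forms with the basis vector `e_{i+1}` (zero-indexed). -/
def contract (F : Type*) [Field F] (N : ℕ) (i : Fin N) : XA F N →ₗ[F] XA F N :=
  CliffordAlgebra.contractLeft (Q := (0 : QuadraticForm F (Fin N → F))) (LinearMap.proj i)

theorem contract_ι (i : Fin N) (u : Fin N → F) :
    contract F N i (ExteriorAlgebra.ι F u) = algebraMap F _ (u i) :=
  CliffordAlgebra.contractLeft_ι (0 : QuadraticForm F (Fin N → F)) (LinearMap.proj i) u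

theorem contract_ι_mul (i : Fin N) (u : Fin N → F) (b : XA F N) :
    contract F N i (ExteriorAlgebra.ι F u * b) =
      algebraMap F _ (u i) * b - ExteriorAlgebra.ι F u * contract F N i b := by
  rw [← Algebra.smul_def]
  exact CliffordAlgebra.contractLeft_ι_mul (Q := (0 : QuadraticForm F (Fin N → F)))
    (d := LinearMap.proj i) u b

theorem contract_gen (i j : Fin N) :
    contract F N i (gen F N j) = if i = j then 1 else 0 := by
  rw [gen, contract_ι, Pi.single_apply]
  split_ifs <;> simp

theorem isDeriv_contract [CharP F 2] (i : Fin N) : IsDeriv F N (contract F N i) := by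
  intro a b
  induction a using ExteriorAlgebra.induction generalizing b with
  | algebraMap r =>
    simp [contract, CliffordAlgebra.contractLeft_algebraMap_mul,
      CliffordAlgebra.contractLeft_algebraMap]
  | ι u =>
    rw [contract_ι_mul, contract_ι, sub_eq_iff_eq_add, add_assoc,
      add_self_eq_zero_of_charTwo (F := F), add_zero]
  | mul a c ha hc => rw [mul_assoc, ha, hc, ha, mul_add, add_mul]; simp only [mul_assoc, add_assoc]
  | add a c ha hc => rw [add_mul, map_add, ha, hc, map_add]; simp only [add_mul]; abel

theorem contract_mul_contract (i : Fin N) : contract F N i * contract F N i = 0 :=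
  LinearMap.ext fun x => CliffordAlgebra.contractLeft_contractLeft _ x

theorem gen_mem_grade (i : Fin N) : gen F N i ∈ grade F N 1 := by
  rw [grade, pow_one]
  exact ⟨_, rfl⟩

theorem mul_mem_grade {x y : XA F N} {j k : ℕ} (hx : x ∈ grade F N j) (hy : y ∈ grade F N k) :
    x * y ∈ grade F N (j + k) := by
  rw [grade, pow_add]
  exact Submodule.mul_mem_mul hx hy

theorem map_ι_mem {D : XA F N →ₗ[F] XA F N} {S : Submodule F (XA F N)}
    (h : ∀ i, D (gen F N i) ∈ S) (u : Fin N → F) : D (ExteriorAlgebra.ι F u) ∈ S := by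
  rw [← Finset.univ_sum_single u, map_sum, map_sum]
  refine sum_mem fun i _ => ?_
  have := S.smul_mem (u i) (h i)
  rwa [gen, ← map_smul, ← map_smul, ← Pi.single_smul, smul_eq_mul, mul_one] at this

namespace Isd0

variable {d : XA F N →ₗ[F] XA F N}

theorem map_mem_grade (h : Isd0 F N d) (k : ℕ) {x : XA F N}
    (hx : x ∈ grade F N (k + 1)) : d x ∈ grade F N (k + 2) := by
  refine h.1.mem_grade (map_ι_mem fun ⟨i, hi⟩ => ?_) k hx
  obtain hi' | ⟨m, rfl⟩ : i ≤ 1 ∨ ∃ m, i = m + 2 :=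
    (le_or_gt i 1).imp_right fun h => ⟨i - 2, by omega⟩
  · rw [h.2.1 _ hi']; exact zero_mem _
  · rw [h.2.2 m hi]; exact mul_mem_grade (gen_mem_grade _) (gen_mem_grade _)

theorem mul_self [CharP F 2] (h : Isd0 F N d) : d * d = 0 := by
  refine h.1.sq.ext IsDeriv.zero fun ⟨i, hi⟩ => ?_
  rw [Module.End.mul_apply, LinearMap.zero_apply]
  obtain hi' | rfl | ⟨m, rfl⟩ : i ≤ 1 ∨ i = 2 ∨ ∃ m, i = m + 3 := by
    rcases i with _ | _ | _ | m <;> simp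
  · rw [h.2.1 _ hi', map_zero]
  · rw [h.2.2 0 hi, h.1, h.2.1 _ (by simp), h.2.1 _ (by simp)]; simp
  · rw [h.2.2 (m + 1) hi, h.1, h.2.1 _ (by simp), h.2.2 m (by omega), ← mul_assoc, gen_mul_self]
    simp

theorem lieDerivative_gen_of_le (h : Isd0 F N d) (i : Fin N) (hi : (i : ℕ) ≤ 1) (j : Fin N) :
    (contract F N j * d + d * contract F N j) (gen F N i) = 0 := by
  rw [LinearMap.add_apply, Module.End.mul_apply, Module.End.mul_apply, h.2.1 i hi, contract_gen]
  split_ifs <;> simp [h.1.map_one]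

theorem lieDerivative_gen [CharP F 2] (h : Isd0 F N d) (m : ℕ) (hm : m + 3 ≤ N) :
    (contract F N ⟨0, by omega⟩ * d + d * contract F N ⟨0, by omega⟩)
      (gen F N ⟨m + 2, by omega⟩) = gen F N ⟨m + 1, by omega⟩ := by
  rw [LinearMap.add_apply, Module.End.mul_apply, Module.End.mul_apply, h.2.2 m hm,
    isDeriv_contract]
  simp [contract_gen]

/-- In characteristic two the second summand of the differential of `m2(N)` is `e^2 ∧ L²`,
where `L` is the Lie derivative along `e_1`, written by Cartan's formula. -/
theorem eq_add_mulLeft_mul_sq [CharP F 2] (h : Isd0 F N d) {d' : XA F N →ₗ[F] XA F N}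
    (h' : Isd2 F N d') (hN : 3 ≤ N) :
    d' = d + LinearMap.mulLeft F (gen F N ⟨1, by omega⟩) *
      ((contract F N ⟨0, by omega⟩ * d + d * contract F N ⟨0, by omega⟩) *
        (contract F N ⟨0, by omega⟩ * d + d * contract F N ⟨0, by omega⟩)) := by
  have hL := (isDeriv_contract (F := F) ⟨0, by omega⟩).bracket h.1
  refine h'.1.ext (h.1.add (hL.sq.mulLeft _)) fun ⟨i, hi⟩ => ?_
  rw [LinearMap.add_apply, Module.End.mul_apply, Module.End.mul_apply, LinearMap.mulLeft_apply]
  obtain hi' | rfl | rfl | ⟨m, rfl⟩ : i ≤ 1 ∨ i = 2 ∨ i = 3 ∨ ∃ m, i = m + 4 := by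
    rcases i with _ | _ | _ | _ | m <;> simp
  · rw [h.lieDerivative_gen_of_le _ hi', h.2.1 _ hi', h'.2.1 _ hi']; simp
  · rw [h.lieDerivative_gen 0 hi, h.lieDerivative_gen_of_le _ le_rfl, h.2.2 0 hi,
      h'.2.2.1 0 hi (by simp)]
    simp
  · rw [h.lieDerivative_gen 1 hi, h.lieDerivative_gen 0 (by omega), h.2.2 1 hi,
      h'.2.2.1 1 hi le_rfl, gen_mul_self, add_zero]
  · rw [h.lieDerivative_gen (m + 2) hi, h.lieDerivative_gen (m + 1) (by omega),
      h.2.2 (m + 2) hi, h'.2.2.2 m hi]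

end Isd0

/-- If a linear involution preserving `k`-forms intertwines two maps, then their kernels on
`k`-forms have the same dimension. -/
theorem finrank_cocycles_eq_of_intertwine {d d' φ : XA F N →ₗ[F] XA F N} {k : ℕ}
    (hφ : φ * φ = 1) (hd : d' * φ = φ * d) (hk : ∀ x ∈ grade F N k, φ x ∈ grade F N k) :
    Module.finrank F (cocycles F N d k) = Module.finrank F (cocycles F N d' k) := by
  have hφ' (x : XA F N) : φ (φ x) = x := LinearMap.congr_fun hφ x
  have hd' (x : XA F N) : d' (φ x) = φ (d x) := LinearMap.congr_fun hd x
  let Φ : XA F N ≃ₗ[F] XA F N := LinearEquiv.ofInvolutive φ hφ'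
  have hmap : (cocycles F N d k).map (Φ : XA F N →ₗ[F] XA F N) = cocycles F N d' k := by
    ext x
    simp only [cocycles, Submodule.mem_map, Submodule.mem_inf, LinearMap.mem_ker]
    constructor
    · rintro ⟨y, ⟨hy, hy'⟩, rfl⟩
      exact ⟨hk y hy, (hd' y).trans (by rw [hy', map_zero])⟩
    · rintro ⟨hx, hx'⟩
      refine ⟨φ x, ⟨hk x hx, ?_⟩, hφ' x⟩
      rw [← hφ' (d (φ x)), ← hd', hφ', hx', map_zero]
  rw [← hmap, LinearEquiv.finrank_map_eq]

/-- With `L = i d + d i`, the map `1 + e L i` conjugates `d` into `d + e L²`. -/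
theorem intertwine_of_commute {A : Type*} [Ring A] (h₂ : ∀ a : A, a + a = 0) {e i d : A}
    (he : e * e = 0) (hi : i * i = 0) (hd : d * d = 0) (hei : Commute e i) (hed : Commute e d) :
    (d + e * ((i * d + d * i) * (i * d + d * i))) * (1 + e * (i * d * i)) =
      (1 + e * (i * d * i)) * d := by
  have hL : Commute e ((i * d + d * i) * (i * d + d * i)) := by
    have := (hei.mul_right hed).add_right (hed.mul_right hei)
    exact this.mul_right this
  have hLL : (i * d + d * i) * (i * d + d * i) = i * d * i * d + d * (i * d * i) := by
    have h₁ : i * d * (d * i) = 0 := by rw [mul_assoc, ← mul_assoc d, hd]; simp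
    have h₃ : d * i * (i * d) = 0 := by rw [mul_assoc, ← mul_assoc i, hi]; simp
    rw [mul_add, add_mul, add_mul, h₁, h₃]
    simp [mul_assoc]
  have h₄ : e * ((i * d + d * i) * (i * d + d * i)) * (e * (i * d * i)) = 0 := by
    rw [hL.symm.mul_mul_mul_comm, he, zero_mul]
  have h₅ : d * (e * (i * d * i)) = e * (d * (i * d * i)) := by
    rw [← mul_assoc, ← hed.eq, mul_assoc]
  rw [mul_add, mul_one, add_mul _ _ (e * _), h₄, h₅, hLL, mul_add, add_mul, one_mul, add_zero,
    add_assoc, add_assoc, h₂, add_zero, mul_assoc e]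

end

theorem dim_cocycles_m0_eq_m2 (F : Type*) [Field F] [CharP F 2] (n : ℕ) (hn : 3 ≤ n)
    (d0 d2 : XA F n →ₗ[F] XA F n)
    (hd0 : Isd0 F n d0) (hd2 : Isd2 F n d2) :
    ∀ k : ℕ, 1 ≤ k → k ≤ n →
      Module.finrank F (cocycles F n d0 k) = Module.finrank F (cocycles F n d2 k) := by
  intro k hk _
  obtain ⟨k, rfl⟩ := Nat.exists_eq_add_of_le' hk
  set i := contract F n ⟨0, by omega⟩ with hi_def
  set e := LinearMap.mulLeft F (gen F n ⟨1, by omega⟩) with he_def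
  have h₂ (f : Module.End F (XA F n)) : f + f = 0 := add_self_eq_zero_of_charTwo (F := F) f
  have hder : IsDeriv F n i := isDeriv_contract _
  have he : e * e = 0 := LinearMap.ext fun x => by
    simp [he_def, ← mul_assoc, gen_mul_self]
  have hei : Commute e i := LinearMap.ext fun x => by
    have h0 : i (gen F n ⟨1, by omega⟩) = 0 := by simp [hi_def, contract_gen]
    simp only [he_def, Module.End.mul_apply, LinearMap.mulLeft_apply, hder _ _, h0]
    rw [zero_mul, zero_add]
  have hed : Commute e d0 := LinearMap.ext fun x => by
    simp [he_def, hd0.1 _ _, hd0.2.1 ⟨1, by omega⟩ le_rfl]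
  have hii : i * i = 0 := contract_mul_contract _
  refine finrank_cocycles_eq_of_intertwine (φ := 1 + e * (i * d0 * i)) ?_ ?_ fun x hx => ?_
  · have hc : Commute e (i * d0 * i) := (hei.mul_right hed).mul_right hei
    have h₃ : e * (i * d0 * i) * (e * (i * d0 * i)) = 0 := by
      rw [hc.symm.mul_mul_mul_comm, he, zero_mul]
    rw [mul_add, mul_one, add_mul, h₃, one_mul, add_zero, add_assoc, h₂, add_zero]
  · rw [hd0.eq_add_mulLeft_mul_sq hd2 hn]
    exact intertwine_of_commute h₂ he hii hd0.mul_self hei hed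
  · have hlow (m : ℕ) {y : XA F n} (hy : y ∈ grade F n (m + 1)) : i y ∈ grade F n m :=
      hder.mem_grade (j := 0) (fun u => by
        rw [hi_def, contract_ι, grade, pow_zero]
        exact Submodule.algebraMap_mem _) m hy
    refine add_mem hx ?_
    rw [add_comm k 1]
    refine mul_mem_grade (gen_mem_grade _) ?_
    rcases k with _ | k
    · have hx0 : i x ∈ grade F n 0 := hlow 0 hx
      rw [grade, pow_zero] at hx0
      obtain ⟨r, hr⟩ := Submodule.mem_one.mp hx0
      simp only [Module.End.mul_apply]
      rw [← hr, hd0.1.map_algebraMap, map_zero]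
      exact zero_mem _
    · exact hlow _ (hd0.map_mem_grade k (hlow _ hx))

end Char2Filiform
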